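/- Fix an irrational α with 0 < α < 1, and let f be a measurable Roman dominating function for the irrational cycle graph G_α of measured value exactly 2/3, i.e. 2·μ(f⁻¹{2}) + μ(f⁻¹{1}) = 2/3. Then the set of needy vertices of f, {v ∈ ℝ/ℤ : f(v) = 0 and f(v + α) = 2 and f(v − α) = 2}, is a μ-null set. -/

import Mathlib

open MeasureTheory
open scoped ENNReal

/-- If a measurable Roman dominating function for the irrational cycle graph
`G_α` has measured value exactly `2/3`, then its set of needy vertices is a
null set. -/
theorem needy_vertices_null
    (α : ℝ) (hirr : Irrational α) (h0 : 0 < α) (h1 : α < 1)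
    (f : AddCircle (1:ℝ) → ℕ) (hf2 : ∀ v, f v ≤ 2)
    (hrdf : ∀ v, f v = 0 →
      f (v + (α : AddCircle (1:ℝ))) = 2 ∨ f (v - (α : AddCircle (1:ℝ))) = 2)
    (h1m : MeasurableSet (f ⁻¹' {1})) (h2m : MeasurableSet (f ⁻¹' {2}))
    (hval : 2 * volume (f ⁻¹' {2}) + volume (f ⁻¹' {1}) = 2/3) :
    volume {v : AddCircle (1:ℝ) | f v = 0 ∧
      f (v + (α : AddCircle (1:ℝ))) = 2 ∧ f (v - (α : AddCircle (1:ℝ))) = 2} = 0 := by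
  set x : AddCircle (1:ℝ) := (α : AddCircle (1:ℝ)) with hx
  set V1 := f ⁻¹' {1} with hV1
  set V2 := f ⁻¹' {2} with hV2
  set A := (fun v : AddCircle (1:ℝ) => v + x) ⁻¹' V2 with hA
  set B := (fun v : AddCircle (1:ℝ) => v - x) ⁻¹' V2 with hB
  have mA : MeasurableSet A := (measurable_add_const x) h2m
  have mB : MeasurableSet B := (measurable_sub_const x) h2m
  have vA : volume A = volume V2 := measure_preimage_add_right volume x V2
  have vB : volume B = volume V2 := by
    have := measure_preimage_add_right volume (-x) V2
    simpa only [hB, sub_eq_add_neg] using this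
  have hN : {v : AddCircle (1:ℝ) | f v = 0 ∧ f (v + x) = 2 ∧ f (v - x) = 2} ⊆ A ∩ B := by
    rintro v ⟨-, h, h'⟩
    exact ⟨h, h'⟩
  have huniv : (Set.univ : Set (AddCircle (1:ℝ))) ⊆ (V2 ∪ V1) ∪ (A ∪ B) := by
    intro v _
    have h2 := hf2 v
    have h3 := hrdf v
    simp only [hV1, hV2, hA, hB, Set.mem_union, Set.mem_preimage, Set.mem_singleton_iff]
    rcases (by omega : f v = 0 ∨ f v = 1 ∨ f v = 2) with h | h | h
    · exact Or.inr (h3 h)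
    · exact Or.inl (Or.inr h)
    · exact Or.inl (Or.inl h)
  have e1 : volume.real (A ∪ B) + volume.real (A ∩ B) = volume.real A + volume.real B :=
    measureReal_union_add_inter mB
  have e2 : volume.real (Set.univ : Set (AddCircle (1:ℝ))) ≤
      volume.real ((V2 ∪ V1) ∪ (A ∪ B)) := measureReal_mono huniv
  have e3 := measureReal_union_le (μ := volume) (V2 ∪ V1) (A ∪ B)
  have e4 := measureReal_union_le (μ := volume) V2 V1
  have e5 : volume.real (Set.univ : Set (AddCircle (1:ℝ))) = 1 := by
    simp [measureReal_def, AddCircle.measure_univ]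
  have e6 : volume.real A = volume.real V2 := by simp only [measureReal_def, vA]
  have e7 : volume.real B = volume.real V2 := by simp only [measureReal_def, vB]
  have e8 : 2 * volume.real V2 + volume.real V1 = 2 / 3 := by
    have := congrArg ENNReal.toReal hval
    rw [ENNReal.toReal_add (ENNReal.mul_ne_top (by simp) (measure_ne_top _ _))
      (measure_ne_top _ _), ENNReal.toReal_mul, ENNReal.toReal_div] at this
    simpa [measureReal_def] using this
  have p1 : 0 ≤ volume.real V1 := measureReal_nonneg
  have p2 : 0 ≤ volume.real (A ∩ B) := measureReal_nonneg
  have h : volume.real (A ∩ B) = 0 := by linarith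
  exact measure_mono_null hN ((measureReal_eq_zero_iff).1 h)
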